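/- Let A be a unital C*-algebra, d a positive natural number, and let P : A^d → A^d be an A-module map that is idempotent and self-adjoint with respect to the A-valued inner product. Let ω_1, …, ω_d ∈ A^d satisfy P ω_k = ω_k for all k, and suppose (ω_k)_{k=1}^d is a Parseval frame for the range of P, i.e. ⟨x, x⟩ = ∑_{k=1}^d ⟨x, ω_k⟩⟨ω_k, x⟩ for every x with Px = x. Define Q : A^d → A^d by Q a := θ_ω(θ_ω^* a), where θ_ω^* a := ∑_{k=1}^d a_k ω_k and θ_ω x := (⟨x, ω_k⟩)_{k=1}^d. Then Q is idempotent, Q is self-adjoint (⟨Qa, b⟩ = ⟨a, Qb⟩ for all a, b ∈ A^d), Q e_k = θ_ω ω_k for each k, and ⟨Q e_k, Q e_k⟩ = ⟨ω_k, ω_k⟩ for each k. -/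

import Mathlib

open Finset

/-- The `A`-valued inner product on the standard Hilbert `A`-module `A^d`:
`⟨x, y⟩ = ∑ i, x i * (y i)^*`. -/
def modInner {A : Type*} [Ring A] [StarRing A] {d : ℕ} (x y : Fin d → A) : A :=
  ∑ i, x i * star (y i)

/-- The standard basis vector `e_k` of `A^d`. -/
def stdVec (A : Type*) [Ring A] {d : ℕ} (k : Fin d) : Fin d → A :=
  fun i => if i = k then 1 else 0

/-- The analysis operator `θ_ω : A^d → A^d` of a family `ω`, `x ↦ (⟨x, ω_k⟩)_k`. -/
def analysisOp {A : Type*} [Ring A] [StarRing A] {d n : ℕ} (ω : Fin n → Fin d → A)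
    (x : Fin d → A) : Fin n → A :=
  fun k => modInner x (ω k)

/-- The synthesis operator `θ_ω^* : A^n → A^d` of a family `ω`, `a ↦ ∑ k, a_k • ω_k`. -/
def synthesisOp {A : Type*} [Ring A] [StarRing A] {d n : ℕ} (ω : Fin n → Fin d → A)
    (a : Fin n → A) : Fin d → A :=
  ∑ k, a k • ω k

section Ring

variable {A : Type*} [Ring A] [StarRing A] {d n : ℕ}

theorem modInner_add_left (x y z : Fin d → A) :
    modInner (x + y) z = modInner x z + modInner y z := by
  simp [modInner, add_mul, sum_add_distrib]

theorem modInner_smul_left (a : A) (x y : Fin d → A) :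
    modInner (a • x) y = a * modInner x y := by
  simp [modInner, mul_sum, mul_assoc]

theorem star_modInner (x y : Fin d → A) : star (modInner x y) = modInner y x := by
  simp [modInner]

theorem modInner_add_right (x y z : Fin d → A) :
    modInner x (y + z) = modInner x y + modInner x z := by
  simp [modInner, mul_add, sum_add_distrib]

theorem modInner_smul_right (a : A) (x y : Fin d → A) :
    modInner x (a • y) = modInner x y * star a := by
  simp [modInner, sum_mul, mul_assoc]

theorem modInner_stdVec (x : Fin d → A) (k : Fin d) : modInner x (stdVec A k) = x k := by
  simp [modInner, stdVec, apply_ite star]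

theorem modInner_left_ext {x y : Fin d → A} (h : ∀ z, modInner x z = modInner y z) : x = y := by
  funext k
  simpa only [modInner_stdVec] using h (stdVec A k)

theorem analysisOp_add (ω : Fin n → Fin d → A) (x y : Fin d → A) :
    analysisOp ω (x + y) = analysisOp ω x + analysisOp ω y :=
  funext fun k => modInner_add_left x y (ω k)

theorem analysisOp_smul (ω : Fin n → Fin d → A) (a : A) (x : Fin d → A) :
    analysisOp ω (a • x) = a • analysisOp ω x :=
  funext fun k => modInner_smul_left a x (ω k)

theorem synthesisOp_stdVec (ω : Fin n → Fin d → A) (k : Fin n) :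
    synthesisOp ω (stdVec A k) = ω k := by
  simp [synthesisOp, stdVec, ite_smul]

/-- The synthesis operator is the adjoint of the analysis operator. -/
theorem modInner_synthesisOp_left (ω : Fin n → Fin d → A) (a : Fin n → A) (x : Fin d → A) :
    modInner (synthesisOp ω a) x = modInner a (analysisOp ω x) := by
  simp only [modInner, synthesisOp, analysisOp, Finset.sum_apply, Pi.smul_apply, smul_eq_mul,
    star_sum, star_mul, star_star, sum_mul, mul_sum, mul_assoc]
  exact sum_comm

theorem modInner_analysisOp_left (ω : Fin n → Fin d → A) (x : Fin d → A) (a : Fin n → A) :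
    modInner (analysisOp ω x) a = modInner x (synthesisOp ω a) := by
  rw [← star_modInner, ← modInner_synthesisOp_left, star_modInner]

theorem map_synthesisOp_of_fixed {P : (Fin d → A) →ₗ[A] (Fin d → A)} {ω : Fin n → Fin d → A}
    (hω : ∀ k, P (ω k) = ω k) (a : Fin n → A) :
    P (synthesisOp ω a) = synthesisOp ω a := by
  simp only [synthesisOp, map_sum, map_smul, hω]

end Ring

/-- Polarization: an `A`-linear map preserving `⟨x, x⟩` on a submodule preserves `⟨x, y⟩`. -/
theorem modInner_analysisOp_of_parseval {A : Type*} [CStarAlgebra A] {d n : ℕ}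
    (M : Submodule A (Fin d → A)) (ω : Fin n → Fin d → A)
    (h : ∀ x ∈ M, modInner (analysisOp ω x) (analysisOp ω x) = modInner x x)
    {x y : Fin d → A} (hx : x ∈ M) (hy : y ∈ M) :
    modInner (analysisOp ω x) (analysisOp ω y) = modInner x y := by
  set D : A := modInner (analysisOp ω x) (analysisOp ω y) - modInner x y with hD
  set E : A := modInner (analysisOp ω y) (analysisOp ω x) - modInner y x with hE
  have polar (u : A) : u * D + E * star u = 0 := by
    have hu := h _ (M.add_mem (M.smul_mem u hx) hy)
    simp only [analysisOp_add, analysisOp_smul, modInner_add_left, modInner_add_right,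
      modInner_smul_left, modInner_smul_right] at hu
    rw [h x hx, h y hy, add_mul, add_mul] at hu
    rw [hD, hE, mul_sub, sub_mul]
    linear_combination (norm := abel) hu
  have h_add : D + E = 0 := by simpa using polar 1
  have h_sub : D - E = 0 := by
    have hI := polar (algebraMap ℂ A Complex.I)
    rw [← algebraMap_star_comm, ← Algebra.commutes, ← Algebra.smul_def, ← Algebra.smul_def] at hI
    have hI' : Complex.I • (D - E) = 0 := by
      simpa [smul_sub, sub_eq_add_neg] using hI
    exact (smul_eq_zero.mp hI').resolve_left Complex.I_ne_zero
  have h_two : (2 : ℂ) • D = 0 := by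
    rw [two_smul]
    linear_combination (norm := abel) h_add + h_sub
  exact sub_eq_zero.mp ((smul_eq_zero.mp h_two).resolve_left two_ne_zero)

/-- Let `A` be a unital C*-algebra, `d > 0`, `P : A^d → A^d` an idempotent self-adjoint
`A`-module map, and `ω_1, …, ω_d ∈ A^d` with `P ω_k = ω_k`, forming a Parseval frame for the
range of `P`.  Then `Q := θ_ω ∘ θ_ω^*` is idempotent and self-adjoint, `Q e_k = θ_ω ω_k`,
and `⟨Q e_k, Q e_k⟩ = ⟨ω_k, ω_k⟩` for each `k`. -/
theorem synthesis_analysis_projection {A : Type*} [CStarAlgebra A] {d : ℕ} (hd : 0 < d)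
    (P : (Fin d → A) →ₗ[A] (Fin d → A))
    (hidem : ∀ x, P (P x) = P x)
    (hadj : ∀ x y : Fin d → A, modInner (P x) y = modInner x (P y))
    (ω : Fin d → Fin d → A)
    (hrange : ∀ k, P (ω k) = ω k)
    (hparseval : ∀ x : Fin d → A, P x = x →
      modInner x x = ∑ k, modInner x (ω k) * star (modInner x (ω k))) :
    (∀ a : Fin d → A,
        analysisOp ω (synthesisOp ω (analysisOp ω (synthesisOp ω a)))
          = analysisOp ω (synthesisOp ω a)) ∧
    (∀ a b : Fin d → A,
        modInner (analysisOp ω (synthesisOp ω a)) b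
          = modInner a (analysisOp ω (synthesisOp ω b))) ∧
    (∀ k : Fin d, analysisOp ω (synthesisOp ω (stdVec A k)) = analysisOp ω (ω k)) ∧
    (∀ k : Fin d,
        modInner (analysisOp ω (synthesisOp ω (stdVec A k)))
            (analysisOp ω (synthesisOp ω (stdVec A k)))
          = modInner (ω k) (ω k)) := by
  have h_inner {x y : Fin d → A} (hx : P x = x) (hy : P y = y) :
      modInner (analysisOp ω x) (analysisOp ω y) = modInner x y :=
    modInner_analysisOp_of_parseval (LinearMap.eqLocus P LinearMap.id) ω
      (fun z hz => (hparseval z hz).symm) hx hy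
  have h_recon {x : Fin d → A} (hx : P x = x) : synthesisOp ω (analysisOp ω x) = x := by
    refine modInner_left_ext fun y => ?_
    rw [← map_synthesisOp_of_fixed hrange, hadj, modInner_synthesisOp_left,
      h_inner hx (hidem y), ← hadj, hx]
  refine ⟨fun a => ?_, fun a b => ?_, fun k => ?_, fun k => ?_⟩
  · rw [h_recon (map_synthesisOp_of_fixed hrange a)]
  · rw [modInner_analysisOp_left, modInner_synthesisOp_left]
  · rw [synthesisOp_stdVec]
  · rw [synthesisOp_stdVec, h_inner (hrange k) (hrange k)]
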